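/- For all integers t ≥ 1 and k ≥ 4, every partial k-spread in 𝔽_3^{k(t+1)+2} has cardinality at most (3^{k(t+1)+2} − 9)/(3^k − 1) − 5. -/

import Mathlib

/-- A partial `k`-spread in `𝔽_3^n`: a set of `k`-dimensional subspaces
any two distinct members of which intersect trivially. -/
def IsPartialSpread {n : ℕ} (k : ℕ)
    (S : Finset (Submodule (ZMod 3) (Fin n → ZMod 3))) : Prop :=
  (∀ U ∈ S, Module.finrank (ZMod 3) U = k) ∧
  ∀ U ∈ S, ∀ V ∈ S, U ≠ V → U ⊓ V = ⊥

open Classical in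
/-- Averaging: some nonzero functional kills at most a third of `T`. -/
theorem avg_functional {E : Type*} [AddCommGroup E] [Module (ZMod 3) E] [Fintype E]
    [Module.Finite (ZMod 3) E] (T : Finset E) (h0 : (0 : E) ∉ T)
    (hm : 1 ≤ Module.finrank (ZMod 3) E) :
    ∃ f : Module.Dual (ZMod 3) E, f ≠ 0 ∧ 3 * (T.filter (fun v => f v = 0)).card ≤ T.card := by
  by_contra hcon
  push Not at hcon
  have : Finite (Module.Dual (ZMod 3) E) := Module.finite_of_finite (ZMod 3)
  have : Fintype (Module.Dual (ZMod 3) E) := Fintype.ofFinite _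
  have hcard : Fintype.card (Module.Dual (ZMod 3) E) = 3 ^ Module.finrank (ZMod 3) E := by
    rw [Module.card_eq_pow_finrank (K := ZMod 3), Subspace.dual_finrank_eq, ZMod.card]
  have hv : ∀ v ∈ T, 3 * (Finset.univ.filter
      (fun f : Module.Dual (ZMod 3) E => f v = 0)).card = 3 ^ Module.finrank (ZMod 3) E := by
    intro v hvT
    have hv0 : v ≠ 0 := fun h => h0 (h ▸ hvT)
    set e := Module.Dual.eval (ZMod 3) E v with he
    have hene : e ≠ 0 := by
      intro h
      exact hv0 ((Module.eval_apply_eq_zero_iff (ZMod 3) v).1 h)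
    have h1 : (Finset.univ.filter
      (fun f : Module.Dual (ZMod 3) E => f v = 0)).card = Fintype.card (LinearMap.ker e) := by
      rw [Fintype.card_subtype]
      congr 1
      ext f
      simp [he]
    have h2 := Module.Dual.finrank_ker_add_one_of_ne_zero hene
    rw [h1, Module.card_eq_pow_finrank (K := ZMod 3), ZMod.card, ← pow_succ', h2,
      Subspace.dual_finrank_eq]
  have hsum : ∑ f : Module.Dual (ZMod 3) E, 3 * (T.filter (fun v => f v = 0)).card
      = T.card * 3 ^ Module.finrank (ZMod 3) E := by
    rw [← Finset.mul_sum]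
    have := Finset.sum_card_bipartiteAbove_eq_sum_card_bipartiteBelow
      (s := (Finset.univ : Finset (Module.Dual (ZMod 3) E))) (t := T) (fun f v => f v = 0)
    simp only [Finset.bipartiteAbove, Finset.bipartiteBelow] at this
    rw [this, Finset.mul_sum, Finset.sum_congr rfl hv, Finset.sum_const, smul_eq_mul]
  rw [← Finset.add_sum_erase _ _ (Finset.mem_univ (0 : Module.Dual (ZMod 3) E))] at hsum
  have hge : (3 ^ Module.finrank (ZMod 3) E - 1) * (T.card + 1) ≤
      ∑ f ∈ Finset.univ.erase (0 : Module.Dual (ZMod 3) E),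
        3 * (T.filter (fun v => f v = 0)).card := by
    have := Finset.card_nsmul_le_sum (Finset.univ.erase (0 : Module.Dual (ZMod 3) E))
      (fun f => 3 * (T.filter (fun v => f v = 0)).card) (T.card + 1)
      (fun f hf => hcon f (Finset.ne_of_mem_erase hf))
    rwa [Finset.card_erase_of_mem (Finset.mem_univ _), Finset.card_univ, hcard,
      smul_eq_mul] at this
  have hz : (T.filter (fun v => (0 : Module.Dual (ZMod 3) E) v = 0)).card = T.card := by simp
  rw [hz] at hsum
  have hp : 3 ≤ 3 ^ Module.finrank (ZMod 3) E := Nat.le_self_pow (by omega) 3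
  generalize 3 ^ Module.finrank (ZMod 3) E = p at *
  obtain ⟨q, rfl⟩ : ∃ q, p = q + 1 := ⟨p - 1, by omega⟩
  simp only [Nat.add_sub_cancel] at hge
  nlinarith

open Classical in
/-- Nonzero vectors of `W` not covered by `S`. -/
noncomputable def holes {V : Type*} [AddCommGroup V] [Module (ZMod 3) V] [Fintype V]
    (S : Finset (Submodule (ZMod 3) V)) (W : Submodule (ZMod 3) V) : Finset V :=
  Finset.univ.filter (fun v => v ∈ W ∧ v ≠ 0 ∧ ∀ U ∈ S, v ∉ U)

open Classical in
theorem holes_step {V : Type*} [AddCommGroup V] [Module (ZMod 3) V] [Fintype V]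
    (S : Finset (Submodule (ZMod 3) V)) (W : Submodule (ZMod 3) V)
    (hm : 1 ≤ Module.finrank (ZMod 3) W) :
    ∃ W' : Submodule (ZMod 3) V, Module.finrank (ZMod 3) W' + 1 = Module.finrank (ZMod 3) W ∧
      3 * (holes S W').card ≤ (holes S W).card := by
  set T : Finset W := (Finset.univ : Finset W).filter (fun v => (v : V) ∈ holes S W) with hT
  obtain ⟨f, hf, hle⟩ := avg_functional T (by simp [hT, holes]) hm
  refine ⟨(LinearMap.ker f).map W.subtype, ?_, ?_⟩
  · rw [Submodule.finrank_map_subtype_eq]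
    exact Module.Dual.finrank_ker_add_one_of_ne_zero hf
  · have h1 : (holes S W).card = T.card := by
      rw [← Finset.card_map (Function.Embedding.subtype (fun x => x ∈ W)) (s := T)]
      congr 1
      ext v
      simp [hT, holes]
      tauto
    have h2 : (holes S ((LinearMap.ker f).map W.subtype)).card
        = (T.filter (fun v => f v = 0)).card := by
      rw [← Finset.card_map (Function.Embedding.subtype (fun x => x ∈ W))
        (s := T.filter (fun v => f v = 0))]
      congr 1
      ext v
      simp [hT, holes]
      grind
    rw [h1, h2]
    exact hle

open Classical in
theorem holes_count {V : Type*} [AddCommGroup V] [Module (ZMod 3) V] [Fintype V]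
    (S : Finset (Submodule (ZMod 3) V))
    (hS : ∀ U ∈ S, ∀ U' ∈ S, U ≠ U' → U ⊓ U' = ⊥) (W : Submodule (ZMod 3) V) :
    (holes S W).card + 1 + ∑ U ∈ S, 3 ^ Module.finrank (ZMod 3) (W ⊓ U : Submodule (ZMod 3) V)
      = 3 ^ Module.finrank (ZMod 3) W + S.card := by
  have hc : ∀ X : Submodule (ZMod 3) V,
      (Finset.univ.filter (fun v => v ∈ X ∧ v ≠ 0)).card + 1
        = 3 ^ Module.finrank (ZMod 3) X := by
    intro X
    have h1 : (Finset.univ.filter (fun v => v ∈ X)).card = 3 ^ Module.finrank (ZMod 3) X := by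
      have := Module.card_eq_pow_finrank (K := ZMod 3) (V := X)
      rw [ZMod.card, Fintype.card_subtype] at this
      exact this
    rw [← h1, ← Finset.card_erase_add_one (a := (0 : V)) (s := Finset.univ.filter (fun v => v ∈ X))
      (by simp)]
    congr 2
    ext v
    simp
    tauto
  have hdisj : (S : Set (Submodule (ZMod 3) V)).PairwiseDisjoint
      (fun U => Finset.univ.filter (fun v => v ∈ W ⊓ U ∧ v ≠ 0)) := by
    intro U hU U' hU' hne
    rw [Function.onFun, Finset.disjoint_left]
    intro v hv hv'
    simp only [Finset.mem_filter, Finset.mem_univ, true_and, Submodule.mem_inf] at hv hv'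
    have : v ∈ U ⊓ U' := ⟨hv.1.2, hv'.1.2⟩
    rw [hS U hU U' hU' hne] at this
    exact hv.2 ((Submodule.mem_bot _).1 this)
  have hun : Finset.univ.filter (fun v => v ∈ W ∧ v ≠ 0) = holes S W ∪
      S.biUnion (fun U => Finset.univ.filter (fun v => v ∈ W ⊓ U ∧ v ≠ 0)) := by
    ext v
    simp only [holes, Finset.mem_filter, Finset.mem_univ, true_and, Finset.mem_union,
      Finset.mem_biUnion, Submodule.mem_inf]
    grind
  have hd2 : Disjoint (holes S W)
      (S.biUnion (fun U => Finset.univ.filter (fun v => v ∈ W ⊓ U ∧ v ≠ 0))) := by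
    rw [Finset.disjoint_left]
    intro v
    simp only [holes, Finset.mem_filter, Finset.mem_univ, true_and,
      Finset.mem_biUnion, Submodule.mem_inf]
    grind
  rw [← hc W, hun, Finset.card_union_of_disjoint hd2, Finset.card_biUnion hdisj,
    ← Finset.sum_congr rfl (fun U _ => hc (W ⊓ U)), Finset.sum_add_distrib]
  simp
  ring

theorem holes_even {V : Type*} [AddCommGroup V] [Module (ZMod 3) V] [Fintype V]
    (S : Finset (Submodule (ZMod 3) V))
    (hS : ∀ U ∈ S, ∀ U' ∈ S, U ≠ U' → U ⊓ U' = ⊥) (W : Submodule (ZMod 3) V) :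
    (holes S W).card % 2 = 0 := by
  have h := holes_count S hS W
  have h1 : (∑ U ∈ S, 3 ^ Module.finrank (ZMod 3) (W ⊓ U : Submodule (ZMod 3) V)) % 2
      = S.card % 2 := by
    rw [Finset.sum_nat_mod, Finset.sum_congr rfl (g := fun _ => 1)
      (fun U _ => by rw [Nat.pow_mod]; simp)]
    simp
  have h2 : 3 ^ Module.finrank (ZMod 3) W % 2 = 1 := by rw [Nat.pow_mod]; simp
  omega

theorem holes_mod {V : Type*} [AddCommGroup V] [Module (ZMod 3) V] [Fintype V]
    (S : Finset (Submodule (ZMod 3) V))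
    (hS : ∀ U ∈ S, ∀ U' ∈ S, U ≠ U' → U ⊓ U' = ⊥) (W : Submodule (ZMod 3) V)
    (k j a : ℕ) (hdim : ∀ U ∈ S, Module.finrank (ZMod 3) U = k)
    (hW : Module.finrank (ZMod 3) W + j = Module.finrank (ZMod 3) V)
    (ha : a + j = k) (hkV : k ≤ Module.finrank (ZMod 3) V)
    (c : ℕ) (hcard : S.card = 5 + 3 ^ k * c) :
    ∃ z : ℤ, ((holes S W).card : ℤ) = 4 + 3 ^ a * z := by
  have h := holes_count S hS W
  have h1 : 3 ^ a ∣ ∑ U ∈ S, 3 ^ Module.finrank (ZMod 3) (W ⊓ U : Submodule (ZMod 3) V) := by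
    refine Finset.dvd_sum fun U hU => pow_dvd_pow 3 ?_
    have e1 := Submodule.finrank_sup_add_finrank_inf_eq W U
    have e2 := Submodule.finrank_le (W ⊔ U)
    have e3 := hdim U hU
    omega
  obtain ⟨M, hM⟩ := h1
  obtain ⟨P, hP⟩ : 3 ^ a ∣ 3 ^ Module.finrank (ZMod 3) W := pow_dvd_pow 3 (by omega)
  rw [hM, hP, hcard, ← ha, pow_add] at h
  refine ⟨(P : ℤ) + 3 ^ j * c - M, ?_⟩
  zify at h
  linear_combination h

theorem final_arith (y h0 h1 h2 h3 : ℕ) (hy1 : 1 ≤ (y : ℤ)) (hyo : y % 2 = 1) (z1 z2 z3 : ℤ)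
    (h0e : h0 = 324 * y + 4) (hle1 : 3 * h1 ≤ h0) (hle2 : 3 * h2 ≤ h1) (hle3 : 3 * h3 ≤ h2)
    (hz1 : (h1 : ℤ) = 4 + 27 * y * z1) (hz2 : (h2 : ℤ) = 4 + 9 * y * z2)
    (hz3 : (h3 : ℤ) = 4 + 3 * y * z3) (e1 : h1 % 2 = 0) (e2 : h2 % 2 = 0) (e3 : h3 % 2 = 0) :
    False := by
  have hyodd : (y : ℤ) % 2 = 1 := by
    have : y % 2 = 1 := by exact hyo
    omega
  have ev : ∀ z : ℤ, ((y : ℤ) * z) % 2 = 0 → z % 2 = 0 := by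
    intro z hz
    rw [Int.mul_emod, hyodd] at hz
    omega
  have z1e : z1 % 2 = 0 := ev z1 (by rw [mul_assoc] at hz1; omega)
  have z2e : z2 % 2 = 0 := ev z2 (by rw [mul_assoc] at hz2; omega)
  have z1le : z1 ≤ 2 := by
    by_contra hh
    have : 4 ≤ z1 := by omega
    have : (y : ℤ) * 4 ≤ y * z1 := by nlinarith
    rw [mul_assoc] at hz1
    omega
  have b1 : (y : ℤ) * z1 ≤ y * 2 := by nlinarith
  have z2le : z2 ≤ 0 := by
    by_contra hh
    have : 2 ≤ z2 := by omega
    have : (y : ℤ) * 2 ≤ y * z2 := by nlinarith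
    rw [mul_assoc] at hz1 hz2
    omega
  have b2 : (y : ℤ) * z2 ≤ 0 := by nlinarith
  rw [mul_assoc] at hz2 hz3
  omega

/-- For `t ≥ 1` and `k ≥ 4`, every partial `k`-spread in `𝔽_3^{k(t+1)+2}` has
cardinality at most `(3^{k(t+1)+2} − 9)/(3^k − 1) − 5`. -/
theorem partial_spread_ternary_bound (t k : ℕ) (ht : 1 ≤ t) (hk : 4 ≤ k)
    (S : Finset (Submodule (ZMod 3) (Fin (k * (t + 1) + 2) → ZMod 3)))
    (hS : IsPartialSpread k S) :
    S.card ≤ (3 ^ (k * (t + 1) + 2) - 9) / (3 ^ k - 1) - 5 := by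
  by_contra hcon
  push Not at hcon
  obtain ⟨y, hy⟩ : ∃ y, y = 3 ^ (k - 4) := ⟨_, rfl⟩
  have hy1 : 1 ≤ y := hy ▸ Nat.one_le_pow _ _ (by norm_num)
  have hk4 : 3 ^ k = 81 * y := by
    rw [hy, show (81 : ℕ) = 3 ^ 4 by norm_num, ← pow_add]; congr 1; omega
  have hk3 : 3 ^ (k - 1) = 27 * y := by
    rw [hy, show (27 : ℕ) = 3 ^ 3 by norm_num, ← pow_add]; congr 1; omega
  have hk2 : 3 ^ (k - 2) = 9 * y := by
    rw [hy, show (9 : ℕ) = 3 ^ 2 by norm_num, ← pow_add]; congr 1; omega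
  have hk1 : 3 ^ (k - 3) = 3 * y := by
    rw [hy, ← pow_succ']; congr 1; omega
  -- the geometric sum
  obtain ⟨c, hc⟩ : ∃ c, 3 ^ (k * (t + 1)) = (3 ^ k - 1) * (1 + 3 ^ k * c) + 1 := by
    refine ⟨∑ i ∈ Finset.range t, (3 ^ k) ^ i, ?_⟩
    have h1 := Nat.geomSum_eq (m := 3 ^ k) (by omega) t
    have hg := geom_sum_mul (R := ℤ) ((3 : ℤ) ^ k) t
    zify [show 1 ≤ 3 ^ k by omega]
    rw [pow_mul, pow_succ]
    linear_combination -(3 : ℤ) ^ k * hg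
  have hl : (3 ^ (k * (t + 1) + 2) - 9) / (3 ^ k - 1) = 9 * (1 + 3 ^ k * c) := by
    rw [pow_add, hc]
    have : ((3 ^ k - 1) * (1 + 3 ^ k * c) + 1) * 3 ^ 2 - 9
        = (3 ^ k - 1) * (9 * (1 + 3 ^ k * c)) := by
      rw [Nat.sub_eq_iff_eq_add (by omega)]
      ring
    rw [this, Nat.mul_div_cancel_left _ (by omega)]
  rw [hl] at hcon
  obtain ⟨S', hsub, hcard⟩ := Finset.exists_subset_card_eq
    (show 5 + 3 ^ k * (9 * c) ≤ S.card by
      have : 9 * (1 + 3 ^ k * c) = 9 + 3 ^ k * (9 * c) := by ring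
      omega)
  have hd : ∀ U ∈ S', Module.finrank (ZMod 3) U = k := fun U hU => hS.1 U (hsub hU)
  have hi : ∀ U ∈ S', ∀ U' ∈ S', U ≠ U' → U ⊓ U' = ⊥ :=
    fun U hU U' hU' => hS.2 U (hsub hU) U' (hsub hU')
  have hV : Module.finrank (ZMod 3) (Fin (k * (t + 1) + 2) → ZMod 3) = k * (t + 1) + 2 := by
    simp
  have hkn : k + 2 ≤ k * (t + 1) + 2 := by nlinarith
  have h0 : (holes S' ⊤).card = 324 * y + 4 := by
    have h := holes_count S' hi ⊤
    rw [Finset.sum_congr rfl (g := fun _ => 3 ^ k)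
      (fun U hU => by rw [top_inf_eq, hd U hU]), finrank_top, hV, Finset.sum_const, hcard,
      smul_eq_mul, pow_add, hc, hk4] at h
    zify [show 1 ≤ 81 * y by omega] at h ⊢
    linear_combination h
  obtain ⟨W1, hW1, hle1⟩ := holes_step S' ⊤ (by rw [finrank_top, hV]; omega)
  rw [finrank_top] at hW1
  obtain ⟨W2, hW2, hle2⟩ := holes_step S' W1 (by omega)
  obtain ⟨W3, hW3, hle3⟩ := holes_step S' W2 (by omega)
  obtain ⟨z1, hz1⟩ := holes_mod S' hi W1 k 1 (k - 1) hd (by omega) (by omega) (by omega) _ hcard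
  obtain ⟨z2, hz2⟩ := holes_mod S' hi W2 k 2 (k - 2) hd (by omega) (by omega) (by omega) _ hcard
  obtain ⟨z3, hz3⟩ := holes_mod S' hi W3 k 3 (k - 3) hd (by omega) (by omega) (by omega) _ hcard
  have e1 := holes_even S' hi W1
  have e2 := holes_even S' hi W2
  have e3 := holes_even S' hi W3
  zify at hk1 hk2 hk3 hy1
  rw [hk3] at hz1
  rw [hk2] at hz2
  rw [hk1] at hz3
  exact final_arith y _ _ _ _ hy1 (by rw [hy, Nat.pow_mod]; simp) z1 z2 z3 h0 hle1 hle2 hle3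
    hz1 hz2 hz3 e1 e2 e3
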